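/- (Sufficiency of the relaxed Condition 2 for fifth-order accuracy.) Let f : ℝ → ℝ be infinitely differentiable, let x ∈ ℝ, let (A₀, A₁, A₂) = (−1/4, 1/12, −1/12), and let ω_k^+ , ω_k^− : (0,∞) → ℝ (k = 0,1,2) be weight functions of Δx satisfying, for each sign, Σ_{k=0}^{2} ω_k^±(Δx) = 1 for all Δx, ω_k^±(Δx) = d_k + O(Δx²) as Δx → 0⁺ for each k, and Σ_{k=0}^{2} A_k·(ω_k^+(Δx) − ω_k^−(Δx)) = O(Δx³) as Δx → 0⁺. Then (1/Δx)·[Σ_{k=0}^{2} ω_k^+(Δx)·f̂^k(x,Δx) − Σ_{k=0}^{2} ω_k^−(Δx)·f̂^{k,−}(x,Δx)] = f′(x) + O(Δx⁵) as Δx → 0⁺. -/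

import Mathlib

/-- The three third-order WENO reconstructions at the right cell boundary;
those at the left boundary are `wenoFhat f (x - Δx) Δx k`. -/
noncomputable def wenoFhat (f : ℝ → ℝ) (x Δx : ℝ) : Fin 3 → ℝ
  | 0 => (2 * f (x - 2 * Δx) - 7 * f (x - Δx) + 11 * f x) / 6
  | 1 => (-f (x - Δx) + 5 * f x + 2 * f (x + Δx)) / 6
  | 2 => (2 * f x + 5 * f (x + Δx) - f (x + 2 * Δx)) / 6

/-- The ideal weights `(d₀, d₁, d₂) = (1/10, 6/10, 3/10)`. -/
noncomputable def wenoD : Fin 3 → ℝ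
  | 0 => 1 / 10
  | 1 => 6 / 10
  | 2 => 3 / 10

/-- The third-order deviation coefficients `(A₀, A₁, A₂) = (−1/4, 1/12, −1/12)`. -/
noncomputable def wenoA : Fin 3 → ℝ
  | 0 => -1 / 4
  | 1 => 1 / 12
  | 2 => -1 / 12

open Asymptotics Filter Topology in
lemma weno_taylor (f : ℝ → ℝ) (hf : ContDiff ℝ (⊤ : ℕ∞) f) (x : ℝ) :
    ∃ c0 c2 c3 c4 c5 : ℝ, ∃ R : ℝ → ℝ,
      (∀ t, f (x + t) = c0 + deriv f x * t + c2 * t ^ 2 + c3 * t ^ 3 + c4 * t ^ 4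
        + c5 * t ^ 5 + R t) ∧ R =O[𝓝 0] (fun t => t ^ 6) := by
  have h := taylor_isLittleO (f := f) (x₀ := x) (n := 6) (s := Set.univ) convex_univ
    (Set.mem_univ x) ((contDiff_infty.1 hf 6).contDiffOn)
  rw [nhdsWithin_univ] at h
  have ht : Tendsto (fun t : ℝ => x + t) (𝓝 0) (𝓝 x) := by
    have : ContinuousAt (fun t : ℝ => x + t) 0 := by fun_prop
    simpa [ContinuousAt] using this
  have h2 := h.isBigO.comp_tendsto ht
  simp only [Function.comp_def, add_sub_cancel_left, taylorWithinEval_succ, taylor_within_zero_eval,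
    iteratedDerivWithin_univ, iteratedDeriv_one, smul_eq_mul, zero_add] at h2
  refine ⟨f x, iteratedDeriv 2 f x / 2, iteratedDeriv 3 f x / 6, iteratedDeriv 4 f x / 24,
    iteratedDeriv 5 f x / 120, fun t => f (x + t) - (f x + deriv f x * t
    + (iteratedDeriv 2 f x / 2) * t ^ 2 + (iteratedDeriv 3 f x / 6) * t ^ 3
    + (iteratedDeriv 4 f x / 24) * t ^ 4 + (iteratedDeriv 5 f x / 120) * t ^ 5),
    fun t => by ring, ?_⟩
  have h3 : (fun t : ℝ => iteratedDeriv 6 f x / 720 * t ^ 6) =O[𝓝 0] (fun t : ℝ => t ^ 6) :=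
    (isBigO_refl _ _).const_mul_left _
  refine (h2.add h3).congr_left fun t => ?_
  norm_num [Nat.factorial]
  ring

/-- sufficiency of the relaxed Condition 2 for fifth-order accuracy:
if the weights sum to 1, satisfy `ω_k^± = d_k + O(Δx²)`, and
`Σ_k A_k (ω_k⁺ − ω_k⁻) = O(Δx³)`, then the WENO flux difference equals
`f′(x) + O(Δx⁵)` as `Δx → 0⁺`. -/
theorem weno_condition2_sufficient
    (f : ℝ → ℝ) (hf : ContDiff ℝ (⊤ : ℕ∞) f) (x : ℝ)
    (ωp ωm : Fin 3 → ℝ → ℝ)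
    (hsum_p : ∀ Δx : ℝ, 0 < Δx → ∑ k : Fin 3, ωp k Δx = 1)
    (hsum_m : ∀ Δx : ℝ, 0 < Δx → ∑ k : Fin 3, ωm k Δx = 1)
    (hO_p : ∀ k : Fin 3, ∃ C > (0 : ℝ), ∃ δ > (0 : ℝ), ∀ Δx : ℝ, 0 < Δx → Δx < δ →
      |ωp k Δx - wenoD k| ≤ C * Δx ^ 2)
    (hO_m : ∀ k : Fin 3, ∃ C > (0 : ℝ), ∃ δ > (0 : ℝ), ∀ Δx : ℝ, 0 < Δx → Δx < δ →
      |ωm k Δx - wenoD k| ≤ C * Δx ^ 2)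
    (hA : ∃ C > (0 : ℝ), ∃ δ > (0 : ℝ), ∀ Δx : ℝ, 0 < Δx → Δx < δ →
      |∑ k : Fin 3, wenoA k * (ωp k Δx - ωm k Δx)| ≤ C * Δx ^ 3) :
    ∃ C > (0 : ℝ), ∃ δ > (0 : ℝ), ∀ Δx : ℝ, 0 < Δx → Δx < δ →
      |(1 / Δx) * (∑ k : Fin 3, ωp k Δx * wenoFhat f x Δx k
          - ∑ k : Fin 3, ωm k Δx * wenoFhat f (x - Δx) Δx k)
        - deriv f x| ≤ C * Δx ^ 5 := by
  classical
  obtain ⟨c0, c2, c3, c4, c5, R, hR, hRO⟩ := weno_taylor f hf x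
  set c1 := deriv f x with hc1
  have conv : ∀ (g : ℝ → ℝ) (n : ℕ), (∃ C > (0 : ℝ), ∃ δ > (0 : ℝ), ∀ h : ℝ, 0 < h → h < δ →
      |g h| ≤ C * h ^ n) → g =O[nhdsWithin 0 (Set.Ioi 0)] (fun h => h ^ n) := by
    rintro g n ⟨C, -, δ, hδ, H⟩
    refine Asymptotics.IsBigO.of_bound C ?_
    filter_upwards [Ioo_mem_nhdsGT hδ] with h hh
    have := H h hh.1 hh.2
    rwa [Real.norm_eq_abs, Real.norm_eq_abs, abs_of_nonneg (pow_nonneg hh.1.le n)]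
  have ha := fun k => conv _ 2 (hO_p k)
  have hb := fun k => conv _ 2 (hO_m k)
  have hS := conv _ 3 hA
  clear conv hO_p hO_m hA
  set l := nhdsWithin (0 : ℝ) (Set.Ioi 0) with hl
  have hRj : ∀ j : ℝ, (fun h => R (j * h)) =O[l] (fun h => h ^ 6) := by
    intro j
    have ht : Filter.Tendsto (fun h : ℝ => j * h) l (nhds 0) := by
      have : ContinuousAt (fun h : ℝ => j * h) 0 := by fun_prop
      have h2 : Filter.Tendsto (fun h : ℝ => j * h) (nhds 0) (nhds 0) := by
        simpa [ContinuousAt] using this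
      exact h2.mono_left nhdsWithin_le_nhds
    refine (hRO.comp_tendsto ht).trans ?_
    have : ((fun t : ℝ => t ^ 6) ∘ fun h : ℝ => j * h) = fun h => j ^ 6 * h ^ 6 := by
      funext h; simp [mul_pow]
    rw [this]
    exact (Asymptotics.isBigO_refl _ _).const_mul_left _
  have hcomb : ∀ e1 e2 e3 e4 e5 e6 : ℝ, (fun h => e1 * R (-3 * h) + e2 * R (-2 * h)
      + e3 * R (-1 * h) + e4 * R (0 * h) + e5 * R (1 * h) + e6 * R (2 * h))
      =O[l] (fun h => h ^ 6) := fun e1 e2 e3 e4 e5 e6 =>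
    ((((((hRj _).const_mul_left _).add ((hRj _).const_mul_left _)).add
      ((hRj _).const_mul_left _)).add ((hRj _).const_mul_left _)).add
      ((hRj _).const_mul_left _)).add ((hRj _).const_mul_left _)
  have hpow : ∀ m n : ℕ, n ≤ m → (fun h : ℝ => h ^ m) =O[l] (fun h : ℝ => h ^ n) := by
    intro m n hmn
    refine Asymptotics.IsBigO.of_bound 1 ?_
    filter_upwards [Ioo_mem_nhdsGT (zero_lt_one' ℝ)] with h hh
    rw [Real.norm_eq_abs, Real.norm_eq_abs, abs_of_nonneg (pow_nonneg hh.1.le _),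
      abs_of_nonneg (pow_nonneg hh.1.le _), one_mul]
    exact pow_le_pow_of_le_one hh.1.le hh.2.le hmn
  have hcomb4 : ∀ p q e1 e2 e3 e4 e5 e6 : ℝ, (fun h => p * h ^ 4 + q * h ^ 5
      + (e1 * R (-3 * h) + e2 * R (-2 * h)
      + e3 * R (-1 * h) + e4 * R (0 * h) + e5 * R (1 * h) + e6 * R (2 * h)))
      =O[l] (fun h => h ^ 4) := fun p q e1 e2 e3 e4 e5 e6 =>
    (((hpow 4 4 le_rfl).const_mul_left p).add ((hpow 5 4 (by norm_num)).const_mul_left q)).add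
      ((hcomb e1 e2 e3 e4 e5 e6).trans (hpow 6 4 (by norm_num)))
  have f3 : ∀ h, f (x - h - 2 * h) = _ := fun h =>
    (congrArg f (by ring : x - h - 2 * h = x + -3 * h)).trans (hR (-3 * h))
  have f2 : ∀ h, f (x - 2 * h) = _ := fun h =>
    (congrArg f (by ring : x - 2 * h = x + -2 * h)).trans (hR (-2 * h))
  have f2' : ∀ h, f (x - h - h) = _ := fun h =>
    (congrArg f (by ring : x - h - h = x + -2 * h)).trans (hR (-2 * h))
  have f1 : ∀ h, f (x - h) = _ := fun h =>
    (congrArg f (by ring : x - h = x + -1 * h)).trans (hR (-1 * h))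
  have f0 : ∀ h, f x = _ := fun h =>
    (congrArg f (by ring : x = x + 0 * h)).trans (hR (0 * h))
  have f0' : ∀ h, f (x - h + h) = _ := fun h =>
    (congrArg f (by ring : x - h + h = x + 0 * h)).trans (hR (0 * h))
  have g1 : ∀ h, f (x + h) = _ := fun h =>
    (congrArg f (by ring : x + h = x + 1 * h)).trans (hR (1 * h))
  have g1' : ∀ h, f (x - h + 2 * h) = _ := fun h =>
    (congrArg f (by ring : x - h + 2 * h = x + 1 * h)).trans (hR (1 * h))
  have g2 : ∀ h, f (x + 2 * h) = _ := fun h => hR (2 * h)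
  let u : ℝ → ℝ := fun h => c0 + c1 * h / 2 + c2 * h ^ 2 / 6
  let v : ℝ → ℝ := fun h => (c0 - c1 * h + c2 * h ^ 2 - c3 * h ^ 3)
    + (c1 - 2 * c2 * h + 3 * c3 * h ^ 2) * h / 2 + (c2 - 3 * c3 * h) * h ^ 2 / 6
  have hs : ∀ k, (fun h => wenoFhat f x h k - u h - 6 * c3 * wenoA k * h ^ 3)
      =O[l] (fun h => h ^ 4) := by
    intro k
    fin_cases k
    · refine (hcomb4 (c4 * 25 / 6) (c5 * (-57) / 6) 0 (2/6) (-7/6) (11/6) 0 0).congr_left ?_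
      intro h
      simp only [wenoFhat, wenoA, u, Fin.zero_eta]
      rw [f2 h, f1 h, f0 h]; ring
    · refine (hcomb4 (c4 * 1 / 6) (c5 * 3 / 6) 0 0 (-1/6) (5/6) (2/6) 0).congr_left ?_
      intro h
      simp only [wenoFhat, wenoA, u, Fin.mk_one]
      rw [f1 h, f0 h, g1 h]; ring
    · refine (hcomb4 (c4 * (-11) / 6) (c5 * (-27) / 6) 0 0 0 (2/6) (5/6) (-1/6)).congr_left ?_
      intro h
      simp only [wenoFhat, wenoA, u, Fin.reduceFinMk]
      rw [g2 h, f0 h, g1 h]; ring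
  have ht : ∀ k, (fun h => wenoFhat f (x - h) h k - v h - 6 * c3 * wenoA k * h ^ 3)
      =O[l] (fun h => h ^ 4) := by
    intro k
    fin_cases k
    · refine (hcomb4 (c4 * (2*81-7*16+11) / 6) (c5 * (-2*243+7*32-11) / 6)
        (2/6) (-7/6) (11/6) 0 0 0).congr_left ?_
      intro h
      simp only [wenoFhat, wenoA, v, Fin.zero_eta]
      rw [f3 h, f2' h, f1 h]; ring
    · refine (hcomb4 (c4 * (-16+5) / 6) (c5 * (32-5) / 6)
        0 (-1/6) (5/6) (2/6) 0 0).congr_left ?_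
      intro h
      simp only [wenoFhat, wenoA, v, Fin.mk_one]
      rw [f2' h, f1 h, f0' h]; ring
    · refine (hcomb4 (c4 * (2-1) / 6) (c5 * (-2-1) / 6)
        0 0 (2/6) (5/6) (-1/6) 0).congr_left ?_
      intro h
      simp only [wenoFhat, wenoA, v, Fin.reduceFinMk]
      rw [f1 h, f0' h, g1' h]; ring
  have hlin : (fun h => ∑ k, wenoD k * wenoFhat f x h k - ∑ k, wenoD k * wenoFhat f (x - h) h k
      - h * c1) =O[l] (fun h => h ^ 6) := by
    refine (hcomb (-2/60) (15/60) (-60/60) (20/60) (30/60) (-3/60)).congr_left ?_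
    intro h
    simp only [Fin.sum_univ_three, wenoFhat, wenoD]
    rw [f3 h, f2' h, f2 h, f1 h, f0' h, g1' h, g1 h, g2 h, f0 h]; ring
  have h1 : ∀ k, (fun h => (ωp k h - wenoD k) *
      (wenoFhat f x h k - u h - 6 * c3 * wenoA k * h ^ 3)) =O[l] (fun h => h ^ 6) := fun k =>
    ((ha k).mul (hs k)).congr_right fun h => by ring
  have h2 : ∀ k, (fun h => (ωm k h - wenoD k) *
      (wenoFhat f (x - h) h k - v h - 6 * c3 * wenoA k * h ^ 3)) =O[l] (fun h => h ^ 6) := fun k =>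
    ((hb k).mul (ht k)).congr_right fun h => by ring
  have h3 : (fun h => 6 * c3 * (h ^ 3 * ∑ k : Fin 3, wenoA k * (ωp k h - ωm k h)))
      =O[l] (fun h => h ^ 6) :=
    (((hpow 3 3 le_rfl).mul hS).congr_right fun h => by ring).const_mul_left _
  have hE := ((hlin.add (((h1 0).add (h1 1)).add (h1 2))).sub
    (((h2 0).add (h2 1)).add (h2 2))).add h3
  obtain ⟨C, hC, hE⟩ := hE.exists_pos
  have hE := hE.bound
  obtain ⟨δ, hδ, hE⟩ := (mem_nhdsGT_iff_exists_Ioo_subset).1 hE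
  refine ⟨C, hC, δ, hδ, fun h hh hhδ => ?_⟩
  have key := hE ⟨hh, hhδ⟩
  simp only [Set.mem_ofPred_eq, Real.norm_eq_abs] at key
  rw [abs_of_nonneg (pow_nonneg hh.le 6)] at key
  have sp := hsum_p h hh
  have sm := hsum_m h hh
  rw [Fin.sum_univ_three] at sp sm
  have hd : wenoD 0 + wenoD 1 + wenoD 2 = 1 := by norm_num [wenoD]
  have e : (1 / h) * (∑ k : Fin 3, ωp k h * wenoFhat f x h k
          - ∑ k : Fin 3, ωm k h * wenoFhat f (x - h) h k) - c1
      = (∑ k : Fin 3, ωp k h * wenoFhat f x h k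
          - ∑ k : Fin 3, ωm k h * wenoFhat f (x - h) h k - h * c1) / h := by
    field_simp
  rw [e, abs_div, abs_of_pos hh, div_le_iff₀ hh]
  refine le_trans (le_of_eq ?_) (key.trans (le_of_eq (by ring)))
  congr 1
  simp only [Fin.sum_univ_three]
  linear_combination (u h) * (sp - hd) - (v h) * (sm - hd)
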